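/- Let T be an abelian algebra with an element 0 such that {0} is a subuniverse of T, equipped with a compatible partial order ≥ whose least element is 0, and such that for all a, b ∈ T: a ≥ b if and only if for every unary polynomial operation f of T, f(a) = 0 implies f(b) = 0. Then T is strongly rectangular (every 1,1-matrix (p,q,r,s) of T with q = r satisfies r = s), and hence T is strongly abelian. -/

import Mathlib

namespace UA

/-- An algebraic language: a type of operation symbols with arities. -/
structure Lang where
  F : Type
  arity : F → ℕ

variable {L : Lang}

/-- An interpretation of the language `L` on the carrier `A` (an algebra structure). -/
def Interp (L : Lang) (A : Type) : Type :=
  (f : L.F) → ((Fin (L.arity f)) → A) → A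

/-- Terms of the language `L` over a type `X` of variables. -/
inductive Term (L : Lang) (X : Type) : Type
  | var : X → Term L X
  | app : (f : L.F) → ((Fin (L.arity f)) → Term L X) → Term L X

/-- Realization of a term under an assignment of the variables. -/
def Term.realize {A X : Type} (I : Interp L A) (v : X → A) : Term L X → A
  | .var x => v x
  | .app f ts => I f (fun i => (ts i).realize I v)

/-- Relabelling (substitution of variables) of terms. -/
def Term.relabel {X Y : Type} (g : X → Y) : Term L X → Term L Y
  | .var x => .var (g x)
  | .app f ts => .app f (fun i => (ts i).relabel g)

/-- `p` is a polynomial operation of the algebra `(A, I)` with argument-index type `X`: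
it is the realization of a term in variables `X ⊕ Fin m` where the `Fin m` variables
are evaluated at fixed constants. -/
def IsPolyOp {A X : Type} (I : Interp L A) (p : (X → A) → A) : Prop :=
  ∃ (m : ℕ) (t : Term L (X ⊕ Fin m)) (c : Fin m → A),
    ∀ x : X → A, p x = t.realize I (Sum.elim x c)

/-- A unary polynomial operation. -/
def IsUnaryPolyOp {A : Type} (I : Interp L A) (g : A → A) : Prop :=
  IsPolyOp I (fun x : Fin 1 → A => g (x 0))

/-- `(p, q, r, s)` is a `1,1`-matrix of the algebra `(A, I)`. -/
def Is11Matrix {A : Type} (I : Interp L A) (p q r s : A) : Prop :=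
  ∃ (k l : ℕ) (t : ((Fin k ⊕ Fin l) → A) → A), IsPolyOp I t ∧
    ∃ (a b : Fin k → A) (u v : Fin l → A),
      p = t (Sum.elim a u) ∧ q = t (Sum.elim a v) ∧
      r = t (Sum.elim b u) ∧ s = t (Sum.elim b v)

/-- The algebra is abelian: in every `1,1`-matrix, `p = q` implies `r = s`. -/
def IsAbelian {A : Type} (I : Interp L A) : Prop :=
  ∀ p q r s : A, Is11Matrix I p q r s → p = q → r = s

/-- The algebra is strongly rectangular: in every `1,1`-matrix, `q = r` implies `r = s`. -/
def IsStronglyRectangular {A : Type} (I : Interp L A) : Prop :=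
  ∀ p q r s : A, Is11Matrix I p q r s → q = r → r = s

/-- Strongly abelian = abelian + strongly rectangular. -/
def IsStronglyAbelian {A : Type} (I : Interp L A) : Prop :=
  IsAbelian I ∧ IsStronglyRectangular I

/-- The algebra has a Maltsev polynomial operation. -/
def HasMaltsevPoly {A : Type} (I : Interp L A) : Prop :=
  ∃ mOp : (Fin 3 → A) → A, IsPolyOp I mOp ∧
    ∀ x y : A, mOp ![x, y, y] = x ∧ mOp ![y, y, x] = x

/-- Affine = abelian + has a Maltsev polynomial operation. -/
def IsAffine {A : Type} (I : Interp L A) : Prop :=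
  IsAbelian I ∧ HasMaltsevPoly I

/-- The algebra satisfies the identity `e.1 ≈ e.2`. -/
def Satisfies {A : Type} (I : Interp L A) (e : Term L ℕ × Term L ℕ) : Prop :=
  ∀ v : ℕ → A, e.1.realize I v = e.2.realize I v

/-- Membership in the variety `Mod(E)` axiomatized by the set `E` of identities. -/
def InVariety {A : Type} (E : Set (Term L ℕ × Term L ℕ)) (I : Interp L A) : Prop :=
  ∀ e ∈ E, Satisfies I e

/-- `θ` is a congruence on the algebra `(A, I)`. -/
def IsCong {A : Type} (I : Interp L A) (θ : A → A → Prop) : Prop :=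
  Equivalence θ ∧
    ∀ (f : L.F) (a b : Fin (L.arity f) → A),
      (∀ i, θ (a i) (b i)) → θ (I f a) (I f b)

/-- `(p, q, r, s)` is a `θ`-matrix of the algebra `(A, I)`. -/
def IsThetaMatrix {A : Type} (I : Interp L A) (θ : A → A → Prop) (p q r s : A) : Prop :=
  ∃ (k l : ℕ) (t : ((Fin k ⊕ Fin l) → A) → A), IsPolyOp I t ∧
    ∃ (a b : Fin k → A) (u v : Fin l → A),
      (∀ i, θ (a i) (b i)) ∧ (∀ j, θ (u j) (v j)) ∧
      p = t (Sum.elim a u) ∧ q = t (Sum.elim a v) ∧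
      r = t (Sum.elim b u) ∧ s = t (Sum.elim b v)

/-- `θ` is a strongly abelian congruence. -/
def IsStronglyAbelianCong {A : Type} (I : Interp L A) (θ : A → A → Prop) : Prop :=
  ∀ p q r s : A, IsThetaMatrix I θ p q r s → (p = q → r = s) ∧ (q = r → r = s)

/-- `S` is a subuniverse of the algebra `(A, I)`. -/
def IsSubuniverse {A : Type} (I : Interp L A) (S : Set A) : Prop :=
  ∀ (f : L.F) (a : Fin (L.arity f) → A), (∀ i, a i ∈ S) → I f a ∈ S

/-- The substructure (restricted algebra structure) on a subuniverse. -/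
def subInterp {A : Type} (I : Interp L A) (S : Set A) (hS : IsSubuniverse I S) :
    Interp L S :=
  fun f a => ⟨I f (fun i => (a i : A)), hS f _ (fun i => (a i).2)⟩

/-- The componentwise algebra structure on a product. -/
def prodInterp {ι : Type} {A : ι → Type} (I : ∀ i, Interp L (A i)) :
    Interp L (∀ i, A i) :=
  fun f a i => I i f (fun j => a j i)

/-- The componentwise algebra structure on `A × A`. -/
def pairInterp {A : Type} (I : Interp L A) : Interp L (A × A) :=
  fun f a => (I f (fun i => (a i).1), I f (fun i => (a i).2))

/-- `h` is a homomorphism of `L`-algebras. -/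
def IsHom {A B : Type} (I : Interp L A) (J : Interp L B) (h : A → B) : Prop :=
  ∀ (f : L.F) (a : Fin (L.arity f) → A), h (I f a) = J f (fun i => h (a i))

/-- The induced algebra structure on the quotient by a congruence `ρ`
(well-defined, i.e. independent of the chosen representatives, when `ρ` is a congruence). -/
noncomputable def quotInterp {A : Type} (I : Interp L A) (ρ : A → A → Prop) :
    Interp L (Quot ρ) :=
  fun f a => Quot.mk ρ (I f (fun i => (a i).out))

/-- The subuniverse generated by a subset `G`: the intersection of all
subuniverses containing `G`. -/
def GenSub {A : Type} (I : Interp L A) (G : Set A) : Set A :=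
  {x | ∀ S : Set A, IsSubuniverse I S → G ⊆ S → x ∈ S}

theorem genSub_isSubuniverse {A : Type} (I : Interp L A) (G : Set A) :
    IsSubuniverse I (GenSub I G) :=
  fun f a ha S hS hG => hS f a (fun i => ha i S hS hG)

/-- The smallest congruence containing the pair `(x, y)`: the intersection of all
congruences containing it. -/
def genCong {A : Type} (I : Interp L A) (x y : A) : A → A → Prop :=
  fun w z => ∀ ρ : A → A → Prop, IsCong I ρ → ρ x y → ρ w z

/-- The carrier of `A(θ)`, the graph of `θ` inside `A × A`. -/
abbrev ThetaSub {A : Type} (θ : A → A → Prop) : Type := {z : A × A // θ z.1 z.2}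

/-- The substructure `A(θ) ≤ A × A` supported by the graph of `θ`. -/
def thetaSubInterp {A : Type} (I : Interp L A) (θ : A → A → Prop) (hθ : IsCong I θ) :
    Interp L (ThetaSub θ) :=
  fun f a => ⟨(I f (fun i => (a i).1.1), I f (fun i => (a i).1.2)),
    hθ.2 f _ _ (fun i => (a i).2)⟩

/-- The diagonal element `(c, c)` of `A(θ)`. -/
def diagEl {A : Type} {θ : A → A → Prop} (hrefl : ∀ a : A, θ a a) (c : A) :
    ThetaSub θ := ⟨(c, c), hrefl c⟩

/-- `Δ`: the smallest congruence of `A(θ)` containing `D × D`, where `D` is the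
diagonal -- the intersection of all congruences of `A(θ)` containing `D × D`. -/
def DeltaRel {A : Type} (I : Interp L A) (θ : A → A → Prop) (hθ : IsCong I θ) :
    ThetaSub θ → ThetaSub θ → Prop :=
  fun x y => ∀ ρ : ThetaSub θ → ThetaSub θ → Prop,
    IsCong (thetaSubInterp I θ hθ) ρ →
    (∀ c d : A, ρ (diagEl hθ.1.refl c) (diagEl hθ.1.refl d)) → ρ x y

/-- The quotient algebra `S = A(θ)/Δ`. -/
noncomputable def SInterp {A : Type} (I : Interp L A) (θ : A → A → Prop)
    (hθ : IsCong I θ) : Interp L (Quot (DeltaRel I θ hθ)) :=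
  quotInterp (thetaSubInterp I θ hθ) (DeltaRel I θ hθ)

/-- The element `0` of `S = A(θ)/Δ`: the `Δ`-class of a diagonal element. -/
def zeroS {A : Type} (I : Interp L A) (θ : A → A → Prop) (hθ : IsCong I θ) (d : A) :
    Quot (DeltaRel I θ hθ) :=
  Quot.mk _ (diagEl hθ.1.refl d)

/-- The diagonal of `B × B`. -/
def diagSet (B : Type) : Set (B × B) := {z | z.1 = z.2}

/-- The set of pairs `(u j, v j)`. -/
def pairsSet {B : Type} {l : ℕ} (u v : Fin l → B) : Set (B × B) :=
  {z | ∃ j, z = (u j, v j)}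

/-- The carrier of the subalgebra `C ≤ B × B` generated by the diagonal and the
pairs `(u j, v j)`. -/
def CsetOf {L : Lang} {B : Type} (I : Interp L B) {l : ℕ} (u v : Fin l → B) :
    Set (B × B) :=
  GenSub (pairInterp I) (diagSet B ∪ pairsSet u v)

/-- The subalgebra `C ≤ B × B` generated by the diagonal and the pairs `(u j, v j)`. -/
def CInterpOf {L : Lang} {B : Type} (I : Interp L B) {l : ℕ} (u v : Fin l → B) :
    Interp L (CsetOf I u v) :=
  subInterp (pairInterp I) _ (genSub_isSubuniverse _ _)


/-- Simultaneous substitution of terms for the variables of a term. -/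
def Term.subst {X Y : Type} (σ : X → Term L Y) : Term L X → Term L Y
  | .var x => σ x
  | .app f ts => .app f (fun i => (ts i).subst σ)

theorem Term.realize_subst {A X Y : Type} (I : Interp L A) (σ : X → Term L Y) (v : Y → A)
    (t : Term L X) :
    (t.subst σ).realize I v = t.realize I (fun x => (σ x).realize I v) := by
  induction t with
  | var x => rfl
  | app f ts ih => simp only [Term.subst, Term.realize, ih]

theorem Term.realize_relabel {A X Y : Type} (I : Interp L A) (g : X → Y) (v : Y → A)
    (t : Term L X) : (t.relabel g).realize I v = t.realize I (v ∘ g) := by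
  induction t with
  | var x => rfl
  | app f ts ih => simp only [Term.relabel, Term.realize, ih]

/-- Composing a polynomial operation with a unary one gives a polynomial operation. -/
theorem IsUnaryPolyOp.comp_isPolyOp {A X : Type} {I : Interp L A} {g : A → A}
    {t : (X → A) → A} (hg : IsUnaryPolyOp I g) (ht : IsPolyOp I t) :
    IsPolyOp I (fun x => g (t x)) := by
  obtain ⟨m, w, d, hw⟩ := hg
  obtain ⟨n, r, c, hr⟩ := ht
  refine ⟨n + m, w.subst (Sum.elim (fun _ => r.relabel (Sum.map id (Fin.castAdd m)))
    (fun j => .var (.inr (Fin.natAdd n j)))), Fin.append c d, fun x => ?_⟩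
  refine (hw fun _ => t x).trans ?_
  rw [Term.realize_subst]
  congr 1
  funext y
  rcases y with _ | j
  · simp only [Sum.elim_inl, Term.realize_relabel, hr]
    congr 1
    funext y
    rcases y with _ | j <;> simp
  · simp [Term.realize]

/-- Term operations are monotone for a compatible relation. -/
theorem Term.realize_mono {A X : Type} {I : Interp L A} {R : A → A → Prop}
    (hR : ∀ (f : L.F) (a b : Fin (L.arity f) → A), (∀ i, R (a i) (b i)) → R (I f a) (I f b))
    {v w : X → A} (h : ∀ x, R (v x) (w x)) (t : Term L X) :
    R (t.realize I v) (t.realize I w) := by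
  induction t with
  | var x => exact h x
  | app f ts ih => exact hR f _ _ ih

/-- Polynomial operations are monotone for a compatible reflexive relation. -/
theorem IsPolyOp.mono {A X : Type} {I : Interp L A} {R : A → A → Prop} (hrefl : ∀ a, R a a)
    (hR : ∀ (f : L.F) (a b : Fin (L.arity f) → A), (∀ i, R (a i) (b i)) → R (I f a) (I f b))
    {p : (X → A) → A} (hp : IsPolyOp I p) {v w : X → A} (h : ∀ x, R (v x) (w x)) :
    R (p v) (p w) := by
  obtain ⟨m, t, c, ht⟩ := hp
  rw [ht, ht]
  refine t.realize_mono hR ?_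
  rintro (x | j)
  exacts [h x, hrefl _]

/-- The term condition of an abelian algebra, for a polynomial operation. -/
theorem IsAbelian.term_condition {A : Type} {I : Interp L A} (hab : IsAbelian I) {k l : ℕ}
    {t : ((Fin k ⊕ Fin l) → A) → A} (ht : IsPolyOp I t) {a : Fin k → A} {u v : Fin l → A}
    (h : t (Sum.elim a u) = t (Sum.elim a v)) (b : Fin k → A) :
    t (Sum.elim b u) = t (Sum.elim b v) :=
  hab _ _ _ _ ⟨k, l, t, ht, a, b, u, v, rfl, rfl, rfl, rfl⟩ h

/-- Let `T` be an abelian algebra with an element `0` forming a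
one-element subuniverse, with a compatible partial order `≥` whose least element is `0`,
such that `a ≥ b` iff every unary polynomial operation killing `a` also kills `b`.
Then `T` is strongly rectangular, hence strongly abelian. -/
theorem statement12 {L : Lang} {T : Type} (I : Interp L T) (hab : IsAbelian I) (z : T)
    (hsub : ∀ f : L.F, I f (fun _ => z) = z)
    (ge : T → T → Prop)
    (hrefl : ∀ a, ge a a)
    (hantisymm : ∀ a b, ge a b → ge b a → a = b)
    (htrans : ∀ a b c, ge a b → ge b c → ge a c)
    (hcompat : ∀ (f : L.F) (a b : Fin (L.arity f) → T),
      (∀ i, ge (a i) (b i)) → ge (I f a) (I f b))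
    (hleast : ∀ b, ge b z)
    (hchar : ∀ a b, ge a b ↔
      ∀ g : T → T, IsUnaryPolyOp I g → g a = z → g b = z) :
    IsStronglyRectangular I ∧ IsStronglyAbelian I := by
  suffices hrect : IsStronglyRectangular I from ⟨hrect, hab, hrect⟩
  rintro _ _ _ _ ⟨k, l, t, ht, a, b, u, v, rfl, rfl, rfl, rfl⟩ hqr
  have eq_zero {x y : T} (hxy : ge x y) (hx : x = z) : y = z :=
    hantisymm _ _ (hleast y) (hx ▸ hxy)
  have mono {s : ((Fin k ⊕ Fin l) → T) → T} (hs : IsPolyOp I s) {a a' : Fin k → T}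
      {u u' : Fin l → T} (ha : ∀ i, ge (a i) (a' i)) (hu : ∀ j, ge (u j) (u' j)) :
      ge (s (Sum.elim a u)) (s (Sum.elim a' u')) :=
    hs.mono hrefl hcompat (Sum.rec ha hu)
  -- An entry `t(x, y)` lies below `t(a, v) = t(b, u)` as soon as `t(0, y)` does.
  have le_of_row {x : Fin k → T} {y : Fin l → T}
      (hx : ge (t (Sum.elim a v)) (t (Sum.elim x fun _ => z)))
      (hy : ge (t (Sum.elim a v)) (t (Sum.elim (fun _ => z) y))) :
      ge (t (Sum.elim a v)) (t (Sum.elim x y)) := by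
    refine (hchar _ _).2 fun g hg h => ?_
    have hs := hg.comp_isPolyOp ht
    have h0y := (hchar _ _).1 hy g hg h
    have hx0 := (hchar _ _).1 hx g hg h
    have h00 := eq_zero (mono hs (fun _ => hrefl z) fun j => hleast (y j)) h0y
    exact (hab.term_condition hs (h0y.trans h00.symm) x).trans hx0
  have hqp : ge (t (Sum.elim a v)) (t (Sum.elim a u)) :=
    le_of_row (mono ht (fun _ => hrefl _) fun _ => hleast _)
      (hqr ▸ mono ht (fun _ => hleast _) fun _ => hrefl _)
  have hqs : ge (t (Sum.elim a v)) (t (Sum.elim b v)) :=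
    le_of_row (hqr ▸ mono ht (fun _ => hrefl _) fun _ => hleast _)
      (mono ht (fun _ => hleast _) fun _ => hrefl _)
  have hsq : ge (t (Sum.elim b v)) (t (Sum.elim a v)) := by
    refine (hchar _ _).2 fun g hg h => ?_
    have hs := hg.comp_isPolyOp ht
    have hb0 := eq_zero (mono hs (fun i => hrefl (b i)) fun j => hleast (v j)) h
    have hav := hab.term_condition hs (h.trans hb0.symm) a
    have hpq : ge (g (t (Sum.elim a u))) (g (t (Sum.elim a v))) :=
      hav ▸ mono hs (fun i => hrefl (a i)) fun j => hleast (u j)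
    have hqp' : ge (g (t (Sum.elim a v))) (g (t (Sum.elim a u))) :=
      IsPolyOp.mono hrefl hcompat hg (v := fun _ => t (Sum.elim a v))
        (w := fun _ => t (Sum.elim a u)) fun _ => hqp
    have hbu := hab.term_condition hs (hantisymm _ _ hpq hqp') b
    exact (congrArg g hqr).trans (hbu.trans h)
  exact hqr.symm.trans (hantisymm _ _ hqs hsq)

end UA
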